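/- Let d ≥ 2 and let (F1,F2,F3) and (F1',F2',F3') be triples of complete flags of ℂ^d, each in general position. Then there exists g ∈ GL_d(ℂ) with g·F1 = F1', g·F2 = F2' and g·F3 = F3' if and only if T^j(F1,F2,F3) = T^j(F1',F2',F3') for every j ∈ B. -/

import Mathlib

noncomputable section

/-- A complete flag of `ℂ^d`: an increasing chain of subspaces `F 0 ⊆ F 1 ⊆ ⋯` of `ℂ^d`
with `dim (F k) = k` for all `k ≤ d`. -/
def IsCompleteFlag (d : ℕ) (F : ℕ → Submodule ℂ (Fin d → ℂ)) : Prop :=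
  Monotone F ∧ ∀ k, k ≤ d → Module.finrank ℂ ↥(F k) = k

/-- Two complete flags of `ℂ^d` are transverse: `F^k + G^(d-k) = ℂ^d` for all `k`. -/
def TransverseFlags (d : ℕ) (F G : ℕ → Submodule ℂ (Fin d → ℂ)) : Prop :=
  ∀ k, k ≤ d → F k ⊔ G (d - k) = ⊤

/-- The flag `g · F`, whose subspaces are the images `g (F k)`. -/
def flagMap (d : ℕ) (g : Matrix (Fin d) (Fin d) ℂ) (F : ℕ → Submodule ℂ (Fin d → ℂ)) :
    ℕ → Submodule ℂ (Fin d → ℂ) :=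
  fun k => Submodule.map g.mulVecLin (F k)

/-- A triple of flags of `ℂ^d` in general position:
`F1^k1 + F2^k2 + F3^k3 = ℂ^d` whenever `k1 + k2 + k3 = d`. -/
def GenPos3 (d : ℕ) (F1 F2 F3 : ℕ → Submodule ℂ (Fin d → ℂ)) : Prop :=
  ∀ k1 k2 k3 : ℕ, k1 + k2 + k3 = d → F1 k1 ⊔ F2 k2 ⊔ F3 k3 = ⊤

/-- The index set `B`: triples of positive integers summing to `d`. -/
def memB (d : ℕ) (j : ℕ × ℕ × ℕ) : Prop :=
  0 < j.1 ∧ 0 < j.2.1 ∧ 0 < j.2.2 ∧ j.1 + j.2.1 + j.2.2 = d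

/-- The index set `A`: pairs of positive integers summing to `d`. -/
def memA (d : ℕ) (i : ℕ × ℕ) : Prop :=
  0 < i.1 ∧ 0 < i.2 ∧ i.1 + i.2 = d

/-- `v 0, v 1, …, v (d-1)` is a basis adapted to the flag `F`: for every `k ≤ d`, the
subspace `F k` is spanned by the first `k` vectors.  A nonzero element `f^k` of the line
`⋀^k F^k` is then given by `v 0 ∧ ⋯ ∧ v (k-1)`. -/
def IsAdaptedBasis (d : ℕ) (F : ℕ → Submodule ℂ (Fin d → ℂ)) (v : ℕ → Fin d → ℂ) : Prop :=
  ∀ k, k ≤ d → F k = Submodule.span ℂ (v '' {m | m < k})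

/-- A choice of adapted basis for a flag. -/
noncomputable def flagBasis (d : ℕ) (F : ℕ → Submodule ℂ (Fin d → ℂ)) : ℕ → Fin d → ℂ :=
  Classical.epsilon (IsAdaptedBasis d F)

/-- The scalar `f1^a ∧ f2^b ∧ f3^(d-a-b)`: the wedge product of the first `a` vectors of
`v1`, the first `b` vectors of `v2` and the first `d - a - b` vectors of `v3`, viewed as a
complex number via the determinant (i.e. via the standard identification `⋀^d ℂ^d ≅ ℂ`). -/
noncomputable def wedgeDet (d a b : ℕ) (v1 v2 v3 : ℕ → Fin d → ℂ) : ℂ :=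
  Matrix.det (Matrix.of fun (i j : Fin d) =>
    if (i : ℕ) < a then v1 (i : ℕ) j
    else if (i : ℕ) < a + b then v2 ((i : ℕ) - a) j
    else v3 ((i : ℕ) - a - b) j)

/-- The triple ratio `T^j(F1,F2,F3)` of a triple of flags in general position,
for `j = (j1,j2,j3)` with `j1 + j2 + j3 = d`. -/
noncomputable def tripleRatio (d : ℕ) (j : ℕ × ℕ × ℕ)
    (F1 F2 F3 : ℕ → Submodule ℂ (Fin d → ℂ)) : ℂ :=
  (wedgeDet d (j.1 + 1) j.2.1 (flagBasis d F1) (flagBasis d F2) (flagBasis d F3) *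
      wedgeDet d j.1 (j.2.1 - 1) (flagBasis d F1) (flagBasis d F2) (flagBasis d F3) *
      wedgeDet d (j.1 - 1) (j.2.1 + 1) (flagBasis d F1) (flagBasis d F2) (flagBasis d F3)) /
    (wedgeDet d (j.1 - 1) j.2.1 (flagBasis d F1) (flagBasis d F2) (flagBasis d F3) *
      wedgeDet d j.1 (j.2.1 + 1) (flagBasis d F1) (flagBasis d F2) (flagBasis d F3) *
      wedgeDet d (j.1 + 1) (j.2.1 - 1) (flagBasis d F1) (flagBasis d F2) (flagBasis d F3))

/-- A choice of nonzero vector in a (1-dimensional) subspace. -/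
noncomputable def lineVec (d : ℕ) (l : Submodule ℂ (Fin d → ℂ)) : Fin d → ℂ :=
  Classical.epsilon fun v => v ∈ l ∧ v ≠ 0

/-- The double ratio `D^i(G1,G2,ℓ1,ℓ2)` of a pair of transverse flags and a pair of lines,
for `i = (i1,i2)` with `i1 + i2 = d`. -/
noncomputable def doubleRatioLine (d : ℕ) (i : ℕ × ℕ) (G1 G2 : ℕ → Submodule ℂ (Fin d → ℂ))
    (l1 l2 : Submodule ℂ (Fin d → ℂ)) : ℂ :=
  -((wedgeDet d i.1 (i.2 - 1) (flagBasis d G1) (flagBasis d G2) (fun _ => lineVec d l1) *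
        wedgeDet d (i.1 - 1) i.2 (flagBasis d G1) (flagBasis d G2) (fun _ => lineVec d l2)) /
      (wedgeDet d i.1 (i.2 - 1) (flagBasis d G1) (flagBasis d G2) (fun _ => lineVec d l2) *
        wedgeDet d (i.1 - 1) i.2 (flagBasis d G1) (flagBasis d G2) (fun _ => lineVec d l1)))

/-- The double ratio `D^i(G1,G2,H1,H2)` of four flags, which only depends on the
`1`-dimensional parts of `H1` and `H2`. -/
noncomputable def doubleRatio (d : ℕ) (i : ℕ × ℕ)
    (G1 G2 H1 H2 : ℕ → Submodule ℂ (Fin d → ℂ)) : ℂ :=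
  doubleRatioLine d i G1 G2 (H1 1) (H2 1)


lemma flag_top {d : ℕ} {F : ℕ → Submodule ℂ (Fin d → ℂ)} (h : IsCompleteFlag d F) {k : ℕ}
    (hk : d ≤ k) : F k = ⊤ := by
  have : F d = ⊤ := by
    apply Submodule.eq_top_of_finrank_eq
    rw [h.2 d le_rfl]; simp
  exact top_le_iff.1 (this ▸ h.1 hk)

lemma flag_zero {d : ℕ} {F : ℕ → Submodule ℂ (Fin d → ℂ)} (h : IsCompleteFlag d F) :
    F 0 = ⊥ := Submodule.finrank_eq_zero.1 (h.2 0 (Nat.zero_le _))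

lemma flag_succ {d : ℕ} {F : ℕ → Submodule ℂ (Fin d → ℂ)} (h : IsCompleteFlag d F) {k : ℕ}
    (hk : k < d) {x : Fin d → ℂ} (hx : x ∈ F (k + 1)) (hx' : x ∉ F k) :
    F (k + 1) = F k ⊔ Submodule.span ℂ {x} := by
  symm
  apply Submodule.eq_of_le_of_finrank_le
  · exact sup_le (h.1 (Nat.le_succ k)) (by simpa using hx)
  · rw [h.2 (k+1) hk]
    have h0 := h.2 k hk.le
    have : F k < F k ⊔ Submodule.span ℂ {x} := by
      refine lt_of_le_of_ne le_sup_left fun he => hx' ?_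
      rw [he]
      exact le_sup_right (a := F k) (Submodule.mem_span_singleton_self x)
    have := Submodule.finrank_lt_finrank_of_lt this
    omega

lemma span_lt_succ {d : ℕ} (v : ℕ → Fin d → ℂ) (k : ℕ) :
    Submodule.span ℂ (v '' {m | m < k + 1}) =
      Submodule.span ℂ (v '' {m | m < k}) ⊔ Submodule.span ℂ {v k} := by
  rw [← Submodule.span_union, ← Set.image_singleton, ← Set.image_union]
  congr 2
  ext m; simp; omega

lemma adapted_of {d : ℕ} {F : ℕ → Submodule ℂ (Fin d → ℂ)} (h : IsCompleteFlag d F)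
    (v : ℕ → Fin d → ℂ) (hv : ∀ k, k < d → v k ∈ F (k + 1)) (hv' : ∀ k, k < d → v k ∉ F k) :
    IsAdaptedBasis d F v := by
  intro k
  induction k with
  | zero => intro _; simp [flag_zero h]
  | succ k ih =>
    intro hk
    rw [span_lt_succ, ← ih (by omega), flag_succ h hk (hv k hk) (hv' k hk)]

lemma flagBasis_adapted {d : ℕ} {F : ℕ → Submodule ℂ (Fin d → ℂ)} (h : IsCompleteFlag d F) :
    IsAdaptedBasis d F (flagBasis d F) := by
  apply Classical.epsilon_spec (p := IsAdaptedBasis d F)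
  have : ∀ k, ∃ x, k < d → x ∈ F (k + 1) ∧ x ∉ F k := by
    intro k
    by_cases hk : k < d
    · have hlt : F k < F (k + 1) := by
        refine lt_of_le_of_ne (h.1 (Nat.le_succ k)) fun he => ?_
        have h1 := h.2 k hk.le
        rw [he, h.2 (k+1) hk] at h1
        omega
      obtain ⟨x, hx, hx'⟩ := Set.exists_of_ssubset hlt
      exact ⟨x, fun _ => ⟨hx, hx'⟩⟩
    · exact ⟨0, fun h => absurd h hk⟩
  choose v hv using this
  exact ⟨v, adapted_of h v (fun k hk => (hv k hk).1) (fun k hk => (hv k hk).2)⟩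

lemma range_fin_eq {d : ℕ} (v : ℕ → Fin d → ℂ) (k : ℕ) :
    Set.range (fun i : Fin k => v i) = v '' {m | m < k} := by
  ext x; constructor
  · rintro ⟨i, rfl⟩; exact ⟨i, i.2, rfl⟩
  · rintro ⟨m, hm, rfl⟩; exact ⟨⟨m, hm⟩, rfl⟩

lemma adapted_li {d : ℕ} {F : ℕ → Submodule ℂ (Fin d → ℂ)} (h : IsCompleteFlag d F)
    {v : ℕ → Fin d → ℂ} (hv : IsAdaptedBasis d F v) {k : ℕ} (hk : k ≤ d) :
    LinearIndependent ℂ (fun i : Fin k => v i) := by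
  rw [linearIndependent_iff_card_eq_finrank_span, Set.finrank, range_fin_eq, ← hv k hk, h.2 k hk]
  simp

/-- Determinant as a function of the rows. -/
def rdet {d : ℕ} (u : Fin d → Fin d → ℂ) : ℂ := Matrix.detRowAlternating u

lemma rdet_eq {d : ℕ} (u : Fin d → Fin d → ℂ) : rdet u = (Matrix.of u).det := rfl

/-- Rows of the matrix in `wedgeDet`. -/
def wrows (d a b : ℕ) (v1 v2 v3 : ℕ → Fin d → ℂ) : Fin d → Fin d → ℂ := fun i =>
  if (i : ℕ) < a then v1 (i : ℕ)
    else if (i : ℕ) < a + b then v2 ((i : ℕ) - a)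
    else v3 ((i : ℕ) - a - b)

lemma wedgeDet_eq (d a b : ℕ) (v1 v2 v3 : ℕ → Fin d → ℂ) :
    wedgeDet d a b v1 v2 v3 = rdet (wrows d a b v1 v2 v3) := by
  rw [rdet_eq]
  unfold wedgeDet wrows
  congr 1
  ext i j
  simp only [Matrix.of_apply]
  split_ifs <;> rfl

lemma wedge_ne_zero_iff {d a b c : ℕ} (h : a + b + c = d) (v1 v2 v3 : ℕ → Fin d → ℂ) :
    wedgeDet d a b v1 v2 v3 ≠ 0 ↔
      Submodule.span ℂ (v1 '' {m | m < a}) ⊔ Submodule.span ℂ (v2 '' {m | m < b}) ⊔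
        Submodule.span ℂ (v3 '' {m | m < c}) = ⊤ := by
  have hr : Set.range (wrows d a b v1 v2 v3) =
      v1 '' {m | m < a} ∪ v2 '' {m | m < b} ∪ v3 '' {m | m < c} := by
    ext x
    constructor
    · rintro ⟨i, rfl⟩
      have := i.2
      unfold wrows
      split_ifs with h1 h2
      · exact Or.inl (Or.inl ⟨_, h1, rfl⟩)
      · exact Or.inl (Or.inr ⟨_, by simp; omega, rfl⟩)
      · exact Or.inr ⟨_, by simp; omega, rfl⟩
    · rintro ((⟨m, hm, rfl⟩ | ⟨m, hm, rfl⟩) | ⟨m, hm, rfl⟩) <;> simp only [Set.mem_ofPred_eq] at hm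
      · refine ⟨⟨m, by omega⟩, ?_⟩
        simp [wrows, hm]
      · refine ⟨⟨a + m, by omega⟩, ?_⟩
        simp [wrows, hm]
      · refine ⟨⟨a + b + m, by omega⟩, ?_⟩
        have e1 : ¬ (a + b + m < a) := by omega
        have e2 : a + b + m - a - b = m := by omega
        simp [wrows, e1, e2]
  rw [wedgeDet_eq, rdet_eq, ← isUnit_iff_ne_zero, ← Matrix.isUnit_iff_isUnit_det,
    ← Matrix.linearIndependent_rows_iff_isUnit, ← Submodule.span_union, ← Submodule.span_union,
    ← hr, linearIndependent_iff_card_eq_finrank_span]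
  change Fintype.card (Fin d) = Module.finrank ℂ (Submodule.span ℂ (Set.range (wrows d a b v1 v2 v3))) ↔ _
  constructor
  · intro h
    apply Submodule.eq_top_of_finrank_eq
    rw [← h]; simp
  · intro h
    rw [h]; simp

lemma extend_update {d k : ℕ} [DecidableEq (Fin k)] (u : Fin d → Fin d → ℂ) (σ : Fin k → Fin d)
    (hσ : Function.Injective σ) (y : Fin k → Fin d → ℂ) (m : Fin k) (z : Fin d → ℂ) :
    Function.extend σ (Function.update y m z) u =
      Function.update (Function.extend σ y u) (σ m) z := by
  funext i
  by_cases hi : ∃ n, σ n = i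
  · obtain ⟨n, rfl⟩ := hi
    rw [hσ.extend_apply]
    by_cases hn : n = m
    · subst hn; simp
    · rw [Function.update_of_ne (fun h => hn (hσ h)), Function.update_of_ne hn, hσ.extend_apply]
  · rw [Function.extend_apply' _ _ _ hi, Function.update_of_ne (fun h => hi ⟨m, h.symm⟩),
      Function.extend_apply' _ _ _ hi]

/-- Alternating map in a block of rows. -/
def blockAlt {d k : ℕ} (u : Fin d → Fin d → ℂ) (σ : Fin k → Fin d) (hσ : Function.Injective σ) :
    (Fin d → ℂ) [⋀^Fin k]→ₗ[ℂ] ℂ where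
  toFun y := rdet (Function.extend σ y u)
  map_update_add' := by
    intro _ y m p q
    simp only [extend_update u σ hσ]
    exact AlternatingMap.map_update_add _ _ _ _ _
  map_update_smul' := by
    intro _ y m p q
    simp only [extend_update u σ hσ]
    exact AlternatingMap.map_update_smul _ _ _ _ _
  map_eq_zero_of_eq' := by
    intro y i j hij hne
    apply AlternatingMap.map_eq_zero_of_eq (i := σ i) (j := σ j) _ _ _ (fun h => hne (hσ h))
    rw [hσ.extend_apply, hσ.extend_apply, hij]

lemma block_scale {d k : ℕ} (x y : ℕ → Fin d → ℂ)
    (hx : LinearIndependent ℂ (fun i : Fin k => x i))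
    (hy : LinearIndependent ℂ (fun i : Fin k => y i))
    (hs : Submodule.span ℂ (x '' {m | m < k}) = Submodule.span ℂ (y '' {m | m < k})) :
    ∃ ρ : ℂ, ρ ≠ 0 ∧ ∀ (u : Fin d → Fin d → ℂ) (σ : Fin k → Fin d), Function.Injective σ →
      rdet (Function.extend σ (fun i : Fin k => y i) u) =
        ρ * rdet (Function.extend σ (fun i : Fin k => x i) u) := by
  rw [← range_fin_eq, ← range_fin_eq] at hs
  let e := Module.Basis.span hx
  let W := Submodule.span ℂ (Set.range fun i : Fin k => x i)
  have hyW : ∀ i : Fin k, y i ∈ W := fun i => by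
    change _ ∈ Submodule.span ℂ (Set.range fun i : Fin k => x i)
    rw [hs]; exact Submodule.subset_span ⟨i, rfl⟩
  let y' : Fin k → W := fun i => ⟨y i, hyW i⟩
  have hyl : LinearIndependent ℂ y' := by
    apply LinearIndependent.of_comp W.subtype
    exact hy
  refine ⟨e.det y', ?_, ?_⟩
  · rw [← isUnit_iff_ne_zero, ← Module.Basis.is_basis_iff_det]
    refine ⟨hyl, ?_⟩
    apply hyl.span_eq_top_of_card_eq_finrank'
    rw [Module.finrank_eq_card_basis e]
  · intro u σ hσ
    have h := AlternatingMap.eq_smul_basis_det (e := e)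
      ((blockAlt u σ hσ).compLinearMap W.subtype)
    have h2 := congrArg (fun f => f y') h
    have hxe : (fun i => (W.subtype (e i))) = fun i : Fin k => x i := by
      ext i j; simp [e, Module.Basis.span_apply]
    simp only [AlternatingMap.compLinearMap_apply, AlternatingMap.smul_apply, smul_eq_mul] at h2
    change (blockAlt u σ hσ) (fun i : Fin k => y i) = (blockAlt u σ hσ) (fun i => W.subtype (e i)) * _ at h2
    rw [hxe, mul_comm] at h2
    exact h2

lemma block_scale' {d k : ℕ} (x y : ℕ → Fin d → ℂ)
    (hx : LinearIndependent ℂ (fun i : Fin k => x i))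
    (hy : LinearIndependent ℂ (fun i : Fin k => y i))
    (hs : Submodule.span ℂ (x '' {m | m < k}) = Submodule.span ℂ (y '' {m | m < k})) :
    ∃ ρ : ℂ, ρ ≠ 0 ∧ ∀ (u u' : Fin d → Fin d → ℂ) (p : ℕ), p + k ≤ d →
      (∀ i : Fin d, p ≤ i → (i : ℕ) < p + k → u i = x (i - p)) →
      (∀ i : Fin d, p ≤ i → (i : ℕ) < p + k → u' i = y (i - p)) →
      (∀ i : Fin d, ((i : ℕ) < p ∨ p + k ≤ i) → u i = u' i) →
      rdet u' = ρ * rdet u := by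
  obtain ⟨ρ, hρ, h⟩ := block_scale x y hx hy hs
  refine ⟨ρ, hρ, ?_⟩
  intro u u' p hp h1 h2 h3
  let σ : Fin k → Fin d := fun i => ⟨p + i, by omega⟩
  have hσ : Function.Injective σ := by
    intro i j hij
    simp only [σ, Fin.mk.injEq] at hij
    ext; omega
  have hnot : ∀ i : Fin d, (¬ ∃ n, σ n = i) → ((i : ℕ) < p ∨ p + k ≤ i) := by
    intro i hi
    by_contra hc
    push Not at hc
    exact hi ⟨⟨i - p, by omega⟩, by ext; simp [σ]; omega⟩
  have e1 : u = Function.extend σ (fun i : Fin k => x i) u := by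
    funext i
    by_cases hi : ∃ n, σ n = i
    · obtain ⟨n, rfl⟩ := hi
      rw [hσ.extend_apply, h1 _ (by simp [σ]) (by simp [σ])]
      simp [σ]
    · rw [Function.extend_apply' _ _ _ hi]
  have e2 : u' = Function.extend σ (fun i : Fin k => y i) u := by
    funext i
    by_cases hi : ∃ n, σ n = i
    · obtain ⟨n, rfl⟩ := hi
      rw [hσ.extend_apply, h2 _ (by simp [σ]) (by simp [σ])]
      simp [σ]
    · rw [Function.extend_apply' _ _ _ hi, h3 i (hnot i hi)]
  have := h u σ hσ
  rwa [← e1, ← e2] at this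

/-- The block scaling property at block size `k`. -/
def BlockProp (d k : ℕ) (x y : ℕ → Fin d → ℂ) (ρ : ℂ) : Prop :=
  ρ ≠ 0 ∧ ∀ (u u' : Fin d → Fin d → ℂ) (p : ℕ), p + k ≤ d →
      (∀ i : Fin d, p ≤ i → (i : ℕ) < p + k → u i = x (i - p)) →
      (∀ i : Fin d, p ≤ i → (i : ℕ) < p + k → u' i = y (i - p)) →
      (∀ i : Fin d, ((i : ℕ) < p ∨ p + k ≤ i) → u i = u' i) →
      rdet u' = ρ * rdet u

lemma adapted_block {d : ℕ} {F G : ℕ → Submodule ℂ (Fin d → ℂ)} (hF : IsCompleteFlag d F)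
    (hG : IsCompleteFlag d G) {x y : ℕ → Fin d → ℂ} (hx : IsAdaptedBasis d F x)
    (hy : IsAdaptedBasis d G y) :
    ∃ ρ : ℕ → ℂ, ∀ k, k ≤ d → F k = G k → BlockProp d k x y (ρ k) := by
  have : ∀ k, ∃ ρ : ℂ, k ≤ d → F k = G k → BlockProp d k x y ρ := by
    intro k
    by_cases hk : k ≤ d ∧ F k = G k
    · obtain ⟨ρ, h⟩ := block_scale' (k := k) x y (adapted_li hF hx hk.1) (adapted_li hG hy hk.1)
        (by rw [← hx k hk.1, ← hy k hk.1, hk.2])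
      exact ⟨ρ, fun _ _ => h⟩
    · exact ⟨0, fun h1 h2 => absurd ⟨h1, h2⟩ hk⟩
  choose ρ h using this
  exact ⟨ρ, h⟩

lemma wedge_scale1 {d k b : ℕ} {x y : ℕ → Fin d → ℂ} {ρ : ℂ} (h : BlockProp d k x y ρ)
    (hk : k + b ≤ d) (v2 v3 : ℕ → Fin d → ℂ) :
    wedgeDet d k b y v2 v3 = ρ * wedgeDet d k b x v2 v3 := by
  rw [wedgeDet_eq, wedgeDet_eq]
  apply h.2 _ _ 0 (by omega)
  · intro i _ hi
    have : (i : ℕ) < k := by omega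
    simp [wrows, this]
  · intro i _ hi
    have : (i : ℕ) < k := by omega
    simp [wrows, this]
  · intro i hi
    have : ¬ (i : ℕ) < k := by omega
    simp [wrows, this]

lemma wedge_scale2 {d k a : ℕ} {x y : ℕ → Fin d → ℂ} {ρ : ℂ} (h : BlockProp d k x y ρ)
    (hk : a + k ≤ d) (v1 v3 : ℕ → Fin d → ℂ) :
    wedgeDet d a k v1 y v3 = ρ * wedgeDet d a k v1 x v3 := by
  rw [wedgeDet_eq, wedgeDet_eq]
  apply h.2 _ _ a (by omega)
  · intro i _ hi
    have : ¬ (i : ℕ) < a := by omega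
    simp [wrows, this, hi]
  · intro i _ hi
    have : ¬ (i : ℕ) < a := by omega
    simp [wrows, this, hi]
  · intro i hi
    unfold wrows
    split_ifs <;> first | rfl | omega

lemma wedge_scale3 {d k a b : ℕ} {x y : ℕ → Fin d → ℂ} {ρ : ℂ} (h : BlockProp d k x y ρ)
    (hk : a + b + k ≤ d) (v1 v2 z : ℕ → Fin d → ℂ) (hz : ∀ m, m < k → z m = x m)
    (hz' : ∀ m, k ≤ m → a + b + m < d → z m = y m) :
    wedgeDet d a b v1 v2 y = ρ * wedgeDet d a b v1 v2 z := by
  rw [wedgeDet_eq, wedgeDet_eq]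
  apply h.2 _ _ (a + b) (by omega)
  · intro i _ hi
    have h1 : ¬ (i : ℕ) < a := by omega
    have h2 : ¬ (i : ℕ) < a + b := by omega
    simp only [wrows, h1, h2, if_false]
    rw [hz _ (by omega), Nat.sub_sub]
  · intro i _ hi
    have h1 : ¬ (i : ℕ) < a := by omega
    have h2 : ¬ (i : ℕ) < a + b := by omega
    simp only [wrows, h1, h2, if_false]
    rw [Nat.sub_sub]
  · intro i hi
    have := i.2
    unfold wrows
    split_ifs
    · rfl
    · rfl
    · exact hz' _ (by omega) (by omega)

/-- Triple ratio formed with arbitrary values. -/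
def TR (Δ : ℕ → ℕ → ℂ) (j : ℕ × ℕ × ℕ) : ℂ :=
  (Δ (j.1 + 1) j.2.1 * Δ j.1 (j.2.1 - 1) * Δ (j.1 - 1) (j.2.1 + 1)) /
    (Δ (j.1 - 1) j.2.1 * Δ j.1 (j.2.1 + 1) * Δ (j.1 + 1) (j.2.1 - 1))

lemma TR_scale {d : ℕ} {Δ Δ' : ℕ → ℕ → ℂ} {ρ1 ρ2 ρ3 : ℕ → ℂ}
    (hρ1 : ∀ k, k ≤ d → ρ1 k ≠ 0) (hρ2 : ∀ k, k ≤ d → ρ2 k ≠ 0) (hρ3 : ∀ k, k ≤ d → ρ3 k ≠ 0)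
    (h : ∀ a b c, a + b + c = d → Δ' a b = ρ1 a * ρ2 b * ρ3 c * Δ a b)
    {j : ℕ × ℕ × ℕ} (hj : memB d j) : TR Δ' j = TR Δ j := by
  obtain ⟨j1, j2, j3⟩ := j
  obtain ⟨p1, p2, p3, hs⟩ := hj
  simp only at p1 p2 p3 hs
  obtain ⟨a, rfl⟩ : ∃ a, j1 = a + 1 := ⟨j1 - 1, by omega⟩
  obtain ⟨b, rfl⟩ : ∃ b, j2 = b + 1 := ⟨j2 - 1, by omega⟩
  obtain ⟨c, rfl⟩ : ∃ c, j3 = c + 1 := ⟨j3 - 1, by omega⟩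
  simp only [TR, Nat.add_sub_cancel]
  rw [h (a + 1 + 1) (b + 1) c (by omega), h (a + 1) b (c + 1 + 1) (by omega),
    h a (b + 1 + 1) (c + 1) (by omega), h a (b + 1) (c + 1 + 1) (by omega),
    h (a + 1) (b + 1 + 1) c (by omega), h (a + 1 + 1) b (c + 1) (by omega)]
  have n1 := hρ1 a (by omega)
  have n2 := hρ1 (a + 1) (by omega)
  have n3 := hρ1 (a + 1 + 1) (by omega)
  have m1 := hρ2 b (by omega)
  have m2 := hρ2 (b + 1) (by omega)
  have m3 := hρ2 (b + 1 + 1) (by omega)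
  have l1 := hρ3 c (by omega)
  have l2 := hρ3 (c + 1) (by omega)
  have l3 := hρ3 (c + 1 + 1) (by omega)
  have hne : ρ1 a * ρ1 (a + 1) * ρ1 (a + 1 + 1) * (ρ2 b * ρ2 (b + 1) * ρ2 (b + 1 + 1)) *
    (ρ3 c * ρ3 (c + 1) * ρ3 (c + 1 + 1)) ≠ 0 := by positivity
  refine Eq.trans ?_ (mul_div_mul_left _ _ hne)
  congr 1 <;> ring

lemma TR_indep {d : ℕ} {F1 F2 F3 : ℕ → Submodule ℂ (Fin d → ℂ)}
    (h1 : IsCompleteFlag d F1) (h2 : IsCompleteFlag d F2) (h3 : IsCompleteFlag d F3)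
    {v1 v2 v3 w1 w2 w3 : ℕ → Fin d → ℂ}
    (hv1 : IsAdaptedBasis d F1 v1) (hv2 : IsAdaptedBasis d F2 v2) (hv3 : IsAdaptedBasis d F3 v3)
    (hw1 : IsAdaptedBasis d F1 w1) (hw2 : IsAdaptedBasis d F2 w2) (hw3 : IsAdaptedBasis d F3 w3)
    {j : ℕ × ℕ × ℕ} (hj : memB d j) :
    TR (fun a b => wedgeDet d a b w1 w2 w3) j = TR (fun a b => wedgeDet d a b v1 v2 v3) j := by
  obtain ⟨ρ1, r1⟩ := adapted_block h1 h1 hv1 hw1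
  obtain ⟨ρ2, r2⟩ := adapted_block h2 h2 hv2 hw2
  obtain ⟨ρ3, r3⟩ := adapted_block h3 h3 hv3 hw3
  apply TR_scale (ρ1 := ρ1) (ρ2 := ρ2) (ρ3 := ρ3) (fun k hk => (r1 k hk rfl).1)
    (fun k hk => (r2 k hk rfl).1) (fun k hk => (r3 k hk rfl).1) _ hj
  intro a b c habc
  rw [wedge_scale1 (r1 a (by omega) rfl) (by omega), wedge_scale2 (r2 b (by omega) rfl) (by omega),
    wedge_scale3 (r3 c (by omega) rfl) (by omega) v1 v2 v3 (fun _ _ => rfl) (fun _ _ _ => by omega)]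
  ring

lemma wedge_map {d : ℕ} (g : Matrix (Fin d) (Fin d) ℂ) (a b : ℕ) (v1 v2 v3 : ℕ → Fin d → ℂ) :
    wedgeDet d a b (fun k => g.mulVec (v1 k)) (fun k => g.mulVec (v2 k))
      (fun k => g.mulVec (v3 k)) = g.det * wedgeDet d a b v1 v2 v3 := by
  rw [wedgeDet_eq, wedgeDet_eq, rdet_eq, rdet_eq]
  have : Matrix.of (wrows d a b (fun k => g.mulVec (v1 k)) (fun k => g.mulVec (v2 k))
      (fun k => g.mulVec (v3 k))) = Matrix.of (wrows d a b v1 v2 v3) * g.transpose := by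
    ext i j
    have e : wrows d a b (fun k => g.mulVec (v1 k)) (fun k => g.mulVec (v2 k))
      (fun k => g.mulVec (v3 k)) i = g.mulVec (wrows d a b v1 v2 v3 i) := by
      unfold wrows; split_ifs <;> rfl
    simp only [Matrix.of_apply, e, Matrix.mul_apply, Matrix.mulVec, dotProduct,
      Matrix.transpose_apply]
    exact Finset.sum_congr rfl fun _ _ => mul_comm _ _
  rw [this, Matrix.det_mul, Matrix.det_transpose, mul_comm]

lemma mulVecLin_inj {d : ℕ} {g : Matrix (Fin d) (Fin d) ℂ} (hg : IsUnit g) :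
    Function.Injective g.mulVecLin := Matrix.mulVec_injective_iff_isUnit.2 hg

lemma mulVecLin_surj {d : ℕ} {g : Matrix (Fin d) (Fin d) ℂ} (hg : IsUnit g) :
    Function.Surjective g.mulVecLin := Matrix.mulVec_surjective_iff_isUnit.2 hg

lemma flagMap_complete {d : ℕ} {g : Matrix (Fin d) (Fin d) ℂ} (hg : IsUnit g)
    {F : ℕ → Submodule ℂ (Fin d → ℂ)} (h : IsCompleteFlag d F) :
    IsCompleteFlag d (flagMap d g F) := by
  refine ⟨fun a b hab => Submodule.map_mono (h.1 hab), fun k hk => ?_⟩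
  unfold flagMap
  rw [← (Submodule.equivMapOfInjective g.mulVecLin (mulVecLin_inj hg) (F k)).finrank_eq, h.2 k hk]

lemma flagMap_adapted {d : ℕ} (g : Matrix (Fin d) (Fin d) ℂ)
    {F : ℕ → Submodule ℂ (Fin d → ℂ)} {v : ℕ → Fin d → ℂ} (h : IsAdaptedBasis d F v) :
    IsAdaptedBasis d (flagMap d g F) (fun k => g.mulVec (v k)) := by
  intro k hk
  unfold flagMap
  rw [h k hk, Submodule.map_span, Set.image_image]
  rfl

lemma flagMap_genPos {d : ℕ} {g : Matrix (Fin d) (Fin d) ℂ} (hg : IsUnit g)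
    {F1 F2 F3 : ℕ → Submodule ℂ (Fin d → ℂ)} (h : GenPos3 d F1 F2 F3) :
    GenPos3 d (flagMap d g F1) (flagMap d g F2) (flagMap d g F3) := by
  intro a b c habc
  unfold flagMap
  rw [← Submodule.map_sup, ← Submodule.map_sup, h a b c habc, Submodule.map_top,
    LinearMap.range_eq_top.2 (mulVecLin_surj hg)]

lemma tripleRatio_eq (d : ℕ) (j : ℕ × ℕ × ℕ) (F1 F2 F3 : ℕ → Submodule ℂ (Fin d → ℂ)) :
    tripleRatio d j F1 F2 F3 =
      TR (fun a b => wedgeDet d a b (flagBasis d F1) (flagBasis d F2) (flagBasis d F3)) j := by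
  unfold tripleRatio TR
  rfl

lemma tripleRatio_map {d : ℕ} {g : Matrix (Fin d) (Fin d) ℂ} (hg : IsUnit g)
    {F1 F2 F3 : ℕ → Submodule ℂ (Fin d → ℂ)}
    (h1 : IsCompleteFlag d F1) (h2 : IsCompleteFlag d F2) (h3 : IsCompleteFlag d F3)
    {j : ℕ × ℕ × ℕ} (hj : memB d j) :
    tripleRatio d j (flagMap d g F1) (flagMap d g F2) (flagMap d g F3) =
      tripleRatio d j F1 F2 F3 := by
  have hdet : g.det ≠ 0 := ((Matrix.isUnit_iff_isUnit_det g).1 hg).ne_zero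
  have c1 := flagMap_complete hg h1
  have c2 := flagMap_complete hg h2
  have c3 := flagMap_complete hg h3
  have key := TR_indep c1 c2 c3 (flagMap_adapted g (flagBasis_adapted h1))
    (flagMap_adapted g (flagBasis_adapted h2)) (flagMap_adapted g (flagBasis_adapted h3))
    (flagBasis_adapted c1) (flagBasis_adapted c2) (flagBasis_adapted c3) hj
  rw [tripleRatio_eq, tripleRatio_eq, key]
  apply TR_scale (d := d) (ρ1 := fun _ => g.det) (ρ2 := fun _ => 1) (ρ3 := fun _ => 1)
    (fun _ _ => hdet) (fun _ _ => one_ne_zero) (fun _ _ => one_ne_zero) _ hj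
  intro a b c _
  rw [wedge_map]; ring

lemma genPos_disj {d : ℕ} {F1 F2 F3 : ℕ → Submodule ℂ (Fin d → ℂ)}
    (h1 : IsCompleteFlag d F1) (h2 : IsCompleteFlag d F2) (h3 : IsCompleteFlag d F3)
    (hgen : GenPos3 d F1 F2 F3) {a b c : ℕ} (h : a + b + c = d) :
    F1 a ⊓ (F2 b ⊔ F3 c) = ⊥ := by
  have e := Submodule.finrank_sup_add_finrank_inf_eq (F1 a) (F2 b ⊔ F3 c)
  rw [← sup_assoc, hgen a b c h, finrank_top, h1.2 a (by omega), Module.finrank_fin_fun] at e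
  have e2 := Submodule.finrank_add_le_finrank_add_finrank (F2 b) (F3 c)
  rw [h2.2 b (by omega), h3.2 c (by omega)] at e2
  apply Submodule.finrank_eq_zero.1
  omega

lemma inter_lemma {d : ℕ} {F1 F2 F3 : ℕ → Submodule ℂ (Fin d → ℂ)}
    (h1 : IsCompleteFlag d F1) (h2 : IsCompleteFlag d F2) (h3 : IsCompleteFlag d F3)
    (hgen : GenPos3 d F1 F2 F3) {c n : ℕ} (h : c + n = d) {w : Fin d → ℂ}
    (hw : ∀ a b, a + b + c + 1 = d → w ∈ F1 a ⊔ F2 b ⊔ F3 c) : w ∈ F3 c := by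
  have key : ∀ k, k ≤ n → w ∈ F2 (n - k) ⊔ F3 c := by
    intro k
    induction k with
    | zero =>
      intro _
      have := hgen 0 n c (by omega)
      rw [flag_zero h1, bot_sup_eq] at this
      simp [this]
    | succ k ih =>
      intro hk
      have i1 := ih (by omega)
      have i2 := hw k (n - (k + 1)) (by omega)
      rw [sup_assoc, Submodule.mem_sup] at i2
      obtain ⟨x, hx, y, hy, hxy⟩ := i2
      have hy' : y ∈ F2 (n - k) ⊔ F3 c :=
        sup_le_sup_right (h2.1 (by omega : n - (k + 1) ≤ n - k)) _ hy
      have hx' : x ∈ F2 (n - k) ⊔ F3 c := by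
        have : x = w - y := by rw [← hxy]; simp
        rw [this]; exact Submodule.sub_mem _ i1 hy'
      have hx0 : x ∈ F1 k ⊓ (F2 (n - k) ⊔ F3 c) := ⟨hx, hx'⟩
      rw [genPos_disj h1 h2 h3 hgen (by omega), Submodule.mem_bot] at hx0
      rw [← hxy, hx0, zero_add]
      exact hy
  have := key n le_rfl
  rwa [Nat.sub_self, flag_zero h2, bot_sup_eq] at this

lemma wrows_update {d a b c : ℕ} (h : a + b + c < d) (v1 v2 x : ℕ → Fin d → ℂ) (z : Fin d → ℂ) :
    wrows d a b v1 v2 (Function.update x c z) =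
      Function.update (wrows d a b v1 v2 x) ⟨a + b + c, h⟩ z := by
  funext i
  by_cases hi : i = ⟨a + b + c, h⟩
  · subst hi
    have e1 : ¬ (a + b + c < a) := by omega
    have e2 : a + b + c - a - b = c := by omega
    simp [wrows, e1, e2]
  · rw [Function.update_of_ne hi]
    have hi' : (i : ℕ) ≠ a + b + c := fun h => hi (Fin.ext h)
    unfold wrows
    split_ifs
    · rfl
    · rfl
    · rw [Function.update_of_ne (by omega)]

lemma wedge_update_add {d a b c : ℕ} (h : a + b + c < d) (v1 v2 x : ℕ → Fin d → ℂ)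
    (p q : Fin d → ℂ) (t : ℂ) :
    wedgeDet d a b v1 v2 (Function.update x c (p + t • q)) =
      wedgeDet d a b v1 v2 (Function.update x c p) +
        t * wedgeDet d a b v1 v2 (Function.update x c q) := by
  simp only [wedgeDet_eq, wrows_update h]
  unfold rdet
  rw [AlternatingMap.map_update_add, AlternatingMap.map_update_smul, smul_eq_mul]

lemma span_update {d : ℕ} (x : ℕ → Fin d → ℂ) (c : ℕ) (z : Fin d → ℂ) :
    Submodule.span ℂ (Function.update x c z '' {m | m < c + 1}) =
      Submodule.span ℂ (x '' {m | m < c}) ⊔ Submodule.span ℂ {z} := by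
  rw [span_lt_succ, Function.update_self]
  congr 2
  apply Set.image_congr
  intro m hm
  have : m < c := hm
  rw [Function.update_of_ne (by omega)]

lemma step_lemma {d : ℕ} {F1 F2 F3 F3' : ℕ → Submodule ℂ (Fin d → ℂ)}
    (h1 : IsCompleteFlag d F1) (h2 : IsCompleteFlag d F2) (h3 : IsCompleteFlag d F3)
    (h3' : IsCompleteFlag d F3') (hgen : GenPos3 d F1 F2 F3) (hgen' : GenPos3 d F1 F2 F3')
    {c : ℕ} (hc : 1 ≤ c) (hcd : c < d) (heq : ∀ k, k ≤ c → F3 k = F3' k)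
    (hT : ∀ j : ℕ × ℕ × ℕ, memB d j → tripleRatio d j F1 F2 F3 = tripleRatio d j F1 F2 F3') :
    F3 (c + 1) = F3' (c + 1) := by
  simp only [tripleRatio_eq] at hT
  have b1 := flagBasis_adapted h1
  have b2 := flagBasis_adapted h2
  have b3 := flagBasis_adapted h3
  have b3' := flagBasis_adapted h3'
  generalize flagBasis d F1 = v1 at *
  generalize flagBasis d F2 = v2 at *
  generalize flagBasis d F3 = x at *
  generalize flagBasis d F3' = y at *
  obtain ⟨ρ, hρ⟩ := adapted_block h3 h3' b3 b3'
  have hρ' : ∀ k, k ≤ c → BlockProp d k x y (ρ k) := fun k hk => hρ k (by omega) (heq k hk)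
  have ne : ∀ a b, a + b ≤ d → wedgeDet d a b v1 v2 x ≠ 0 := by
    intro a b hab
    rw [wedge_ne_zero_iff (c := d - a - b) (by omega), ← b1 a (by omega), ← b2 b (by omega),
      ← b3 _ (by omega)]
    exact hgen _ _ _ (by omega)
  have ne' : ∀ a b, a + b ≤ d → wedgeDet d a b v1 v2 y ≠ 0 := by
    intro a b hab
    rw [wedge_ne_zero_iff (c := d - a - b) (by omega), ← b1 a (by omega), ← b2 b (by omega),
      ← b3' _ (by omega)]
    exact hgen' _ _ _ (by omega)
  have low : ∀ a b k, k ≤ c → a + b + k = d →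
      wedgeDet d a b v1 v2 y = ρ k * wedgeDet d a b v1 v2 x := by
    intro a b k hk habk
    exact wedge_scale3 (hρ' k hk) (by omega) v1 v2 x (fun _ _ => rfl) (fun _ _ _ => by omega)
  have next : ∀ a b, a + 1 + b + (c + 1) = d →
      wedgeDet d (a + 1) b v1 v2 y * wedgeDet d a (b + 1) v1 v2 x =
        wedgeDet d (a + 1) b v1 v2 x * wedgeDet d a (b + 1) v1 v2 y := by
    intro a b hab
    have := hT (a + 1, b + 1, c) ⟨by simp, by simp, hc, by simp; omega⟩
    simp only [TR, Nat.add_sub_cancel] at this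
    have r1 := (hρ' (c - 1) (by omega)).1
    have r2 := (hρ' c le_rfl).1
    rw [low (a + 1 + 1) (b + 1) (c - 1) (by omega) (by omega),
      low a (b + 1 + 1) c (by omega) (by omega),
      low (a + 1) (b + 1 + 1) (c - 1) (by omega) (by omega),
      low (a + 1 + 1) b c (by omega) (by omega)] at this
    have n1 := ne (a + 1 + 1) (b + 1) (by omega)
    have n2 := ne a (b + 1 + 1) (by omega)
    have n3 := ne (a + 1) (b + 1 + 1) (by omega)
    have n4 := ne (a + 1 + 1) b (by omega)
    have n5 := ne a (b + 1) (by omega)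
    have n6 := ne (a + 1) b (by omega)
    have n5' := ne' a (b + 1) (by omega)
    have n6' := ne' (a + 1) b (by omega)
    generalize wedgeDet d (a + 1 + 1) (b + 1) v1 v2 x = A1 at *
    generalize wedgeDet d a (b + 1 + 1) v1 v2 x = A2 at *
    generalize wedgeDet d (a + 1) (b + 1 + 1) v1 v2 x = A3 at *
    generalize wedgeDet d (a + 1 + 1) b v1 v2 x = A4 at *
    generalize wedgeDet d a (b + 1) v1 v2 x = A5 at *
    generalize wedgeDet d (a + 1) b v1 v2 x = A6 at *
    generalize wedgeDet d a (b + 1) v1 v2 y = A5' at *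
    generalize wedgeDet d (a + 1) b v1 v2 y = A6' at *
    generalize ρ (c - 1) = R1 at *
    generalize ρ c = R2 at *
    rw [div_eq_div_iff (by positivity) (by positivity)] at this
    have hne : A1 * A2 * A3 * A4 * R1 * R2 ≠ 0 := by positivity
    apply mul_left_cancel₀ hne
    linear_combination -this
  obtain ⟨r, hr⟩ : ∃ r, ∀ a b, a + b + c + 1 = d →
      wedgeDet d a b v1 v2 y = r * wedgeDet d a b v1 v2 x := by
    refine ⟨wedgeDet d 0 (d - c - 1) v1 v2 y / wedgeDet d 0 (d - c - 1) v1 v2 x, ?_⟩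
    intro a
    induction a with
    | zero =>
      intro b hb
      have : d - c - 1 = b := by omega
      rw [this, div_mul_cancel₀ _ (ne 0 b (by omega))]
    | succ a ih =>
      intro b hb
      have i1 := ih (b + 1) (by omega)
      have i2 := next a b (by omega)
      rw [i1] at i2
      apply mul_right_cancel₀ (ne a (b + 1) (by omega))
      linear_combination i2
  have rc := (hρ' c le_rfl).1
  have hw : y c - (r / ρ c) • x c ∈ F3 c := by
    apply inter_lemma h1 h2 h3 hgen (n := d - c) (by omega)
    intro a b hab
    have hfull : F1 a ⊔ F2 b ⊔ F3 c ⊔ Submodule.span ℂ {x c} = ⊤ := by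
      rw [sup_assoc, b3 c (by omega), ← span_lt_succ, ← b3 (c + 1) (by omega)]
      exact hgen _ _ _ (by omega)
    have hy : y c ∈ F1 a ⊔ F2 b ⊔ F3 c ⊔ Submodule.span ℂ {x c} := by rw [hfull]; trivial
    obtain ⟨h, hh, z, hz, hhz⟩ := Submodule.mem_sup.1 hy
    obtain ⟨t, rfl⟩ := Submodule.mem_span_singleton.1 hz
    have e1 : wedgeDet d a b v1 v2 y =
        ρ c * wedgeDet d a b v1 v2 (Function.update x c (y c)) := by
      apply wedge_scale3 (hρ' c le_rfl) (by omega)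
      · intro m hm; rw [Function.update_of_ne (by omega)]
      · intro m hm hm'
        have : m = c := by omega
        subst this; simp
    have e0 : wedgeDet d a b v1 v2 (Function.update x c h) = 0 := by
      by_contra hne
      rw [← ne_eq, wedge_ne_zero_iff (c := c + 1) (by omega), span_update, ← b1 a (by omega),
        ← b2 b (by omega), ← b3 c (by omega), ← sup_assoc,
        sup_eq_left.2 (by simpa using hh)] at hne
      have f1 := Submodule.finrank_add_le_finrank_add_finrank (F1 a ⊔ F2 b) (F3 c)
      have f2 := Submodule.finrank_add_le_finrank_add_finrank (F1 a) (F2 b)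
      rw [hne, finrank_top, Module.finrank_fin_fun, h3.2 c (by omega)] at f1
      rw [h1.2 a (by omega), h2.2 b (by omega)] at f2
      omega
    rw [← hhz, wedge_update_add (by omega), e0, zero_add, Function.update_eq_self,
      hr a b (by omega)] at e1
    have hrt : r = ρ c * t := by
      apply mul_right_cancel₀ (ne a b (by omega))
      rw [e1]; ring
    have : r / ρ c = t := by rw [hrt]; field_simp
    rw [this, ← hhz, add_sub_cancel_right]
    exact hh
  have hx : x c ∈ F3 (c + 1) := by
    rw [b3 (c + 1) (by omega)]
    exact Submodule.subset_span ⟨c, Nat.lt_succ_self c, rfl⟩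
  have hyc : y c ∈ F3 (c + 1) := by
    have := Submodule.add_mem _ (h3.1 (Nat.le_succ c) hw) (Submodule.smul_mem _ (r / ρ c) hx)
    simpa using this
  symm
  apply Submodule.eq_of_le_of_finrank_le
  · rw [b3' (c + 1) (by omega), span_lt_succ, ← b3' c (by omega), ← heq c le_rfl]
    exact sup_le (h3.1 (Nat.le_succ c)) (by simpa using hyc)
  · rw [h3.2 _ (by omega), h3'.2 _ (by omega)]

lemma good_adapted {d : ℕ} {F1 F2 F3 : ℕ → Submodule ℂ (Fin d → ℂ)}
    (h1 : IsCompleteFlag d F1) (h2 : IsCompleteFlag d F2) (h3 : IsCompleteFlag d F3)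
    (hgen : GenPos3 d F1 F2 F3) (e : ℕ → Fin d → ℂ)
    (he1 : ∀ k, k < d → e k ∈ F1 (k + 1)) (he2 : ∀ k, k < d → e k ∈ F2 (d - k))
    (he0 : ∀ k, k < d → e k ≠ 0) :
    IsAdaptedBasis d F1 e ∧ IsAdaptedBasis d F2 (fun m => e (d - 1 - m)) := by
  have dis : ∀ a b, a + b = d → ∀ z, z ∈ F1 a → z ∈ F2 b → z = 0 := by
    intro a b hab z hz1 hz2
    have := genPos_disj h1 h2 h3 hgen (a := a) (b := b) (c := 0) (by omega)
    rw [flag_zero h3, sup_bot_eq] at this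
    have hz : z ∈ F1 a ⊓ F2 b := ⟨hz1, hz2⟩
    rwa [this, Submodule.mem_bot] at hz
  constructor
  · apply adapted_of h1 e he1
    intro k hk hmem
    exact he0 k hk (dis k (d - k) (by omega) _ hmem (he2 k hk))
  · apply adapted_of h2
    · intro m hm
      have := he2 (d - 1 - m) (by omega)
      rwa [show d - (d - 1 - m) = m + 1 by omega] at this
    · intro m hm hmem
      exact he0 (d - 1 - m) (by omega) (dis (d - 1 - m + 1) m (by omega) _
        (he1 _ (by omega)) hmem)

lemma normal_basis {d : ℕ} (hd : 2 ≤ d) {F1 F2 F3 : ℕ → Submodule ℂ (Fin d → ℂ)}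
    (h1 : IsCompleteFlag d F1) (h2 : IsCompleteFlag d F2) (h3 : IsCompleteFlag d F3)
    (hgen : GenPos3 d F1 F2 F3) :
    ∃ P : Module.Basis (Fin d) ℂ (Fin d → ℂ),
      (∀ k, k ≤ d → F1 k = Submodule.span ℂ (P '' {i | (i : ℕ) < k})) ∧
      (∀ k, k ≤ d → F2 k = Submodule.span ℂ (P '' {i | d - k ≤ (i : ℕ)})) ∧
      F3 1 = Submodule.span ℂ {∑ i, P i} := by
  have ex : ∀ k, ∃ z, k < d → z ∈ F1 (k + 1) ∧ z ∈ F2 (d - k) ∧ z ≠ 0 := by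
    intro k
    by_cases hk : k < d
    · have hne : F1 (k + 1) ⊓ F2 (d - k) ≠ ⊥ := by
        intro hbot
        have f := Submodule.finrank_sup_add_finrank_inf_eq (F1 (k + 1)) (F2 (d - k))
        have f2 := Submodule.finrank_le (F1 (k + 1) ⊔ F2 (d - k))
        rw [Module.finrank_fin_fun] at f2
        rw [hbot, finrank_bot, h1.2 _ (by omega), h2.2 _ (by omega)] at f
        omega
      obtain ⟨z, hz, hz0⟩ := Submodule.exists_mem_ne_zero_of_ne_bot hne
      exact ⟨z, fun _ => ⟨hz.1, hz.2, hz0⟩⟩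
    · exact ⟨0, fun h => absurd h hk⟩
  choose e he using ex
  obtain ⟨a1, -⟩ := good_adapted h1 h2 h3 hgen e (fun k hk => (he k hk).1)
    (fun k hk => (he k hk).2.1) (fun k hk => (he k hk).2.2)
  have b3 := flagBasis_adapted h3
  have hF3 : F3 1 = Submodule.span ℂ {flagBasis d F3 0} := by
    rw [b3 1 (by omega), span_lt_succ]; simp
  have hx : flagBasis d F3 0 ∈ Submodule.span ℂ (Set.range fun i : Fin d => e i) := by
    rw [range_fin_eq, ← a1 d le_rfl, flag_top h1 le_rfl]; trivial
  obtain ⟨t, ht⟩ := (Submodule.mem_span_range_iff_exists_fun ℂ).1 hx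
  have ht0 : ∀ i, t i ≠ 0 := by
    intro i hi
    have hmem : flagBasis d F3 0 ∈ F1 i ⊔ F2 (d - 1 - i) := by
      rw [← ht]
      apply Submodule.sum_mem
      intro j _
      rcases lt_trichotomy (j : ℕ) i with hj | hj | hj
      · apply Submodule.smul_mem
        exact le_sup_left (a := F1 i) (h1.1 (by omega : (j : ℕ) + 1 ≤ i) (he j j.2).1)
      · rw [Fin.ext hj, hi, zero_smul]; exact Submodule.zero_mem _
      · apply Submodule.smul_mem
        exact le_sup_right (a := F1 i) (h2.1 (by omega : d - j ≤ d - 1 - i) (he j j.2).2.1)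
    have htop := hgen i (d - 1 - i) 1 (by omega)
    rw [sup_eq_left.2 (by rw [hF3]; simpa using hmem)] at htop
    have f := Submodule.finrank_add_le_finrank_add_finrank (F1 i) (F2 (d - 1 - i))
    rw [htop, finrank_top, Module.finrank_fin_fun, h1.2 _ (by omega), h2.2 _ (by omega)] at f
    omega
  let e' : ℕ → Fin d → ℂ := fun k => if h : k < d then t ⟨k, h⟩ • e k else 0
  have he' : ∀ k (hk : k < d), e' k = t ⟨k, hk⟩ • e k := fun k hk => by simp [e', hk]
  obtain ⟨c1, c2⟩ := good_adapted h1 h2 h3 hgen e'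
    (fun k hk => by rw [he' k hk]; exact Submodule.smul_mem _ _ (he k hk).1)
    (fun k hk => by rw [he' k hk]; exact Submodule.smul_mem _ _ (he k hk).2.1)
    (fun k hk => by rw [he' k hk]; exact smul_ne_zero (ht0 _) (he k hk).2.2)
  have li := adapted_li h1 c1 le_rfl
  let P : Module.Basis (Fin d) ℂ (Fin d → ℂ) := Module.Basis.mk li (by
    rw [range_fin_eq, ← c1 d le_rfl, flag_top h1 le_rfl])
  have hP : ∀ i : Fin d, P i = e' i := fun i => by simp [P]
  refine ⟨P, ?_, ?_, ?_⟩
  · intro k hk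
    rw [c1 k hk]
    congr 1
    ext z
    constructor
    · rintro ⟨m, hm, rfl⟩
      have hm' : m < k := hm
      exact ⟨⟨m, by omega⟩, hm, hP _⟩
    · rintro ⟨i, hi, rfl⟩
      exact ⟨i, hi, (hP i).symm⟩
  · intro k hk
    rw [c2 k hk]
    congr 1
    ext z
    constructor
    · rintro ⟨m, hm, rfl⟩
      have hm' : m < k := hm
      refine ⟨⟨d - 1 - m, by omega⟩, ?_, hP _⟩
      change d - k ≤ d - 1 - m
      omega
    · rintro ⟨i, hi, rfl⟩
      have hi' : d - k ≤ (i : ℕ) := hi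
      have := i.2
      refine ⟨d - 1 - i, ?_, ?_⟩
      · change d - 1 - (i : ℕ) < k
        omega
      · rw [hP]
        change e' (d - 1 - (d - 1 - i)) = e' i
        congr 1; omega
  · rw [hF3, ← ht]
    congr 2
    exact Finset.sum_congr rfl fun i _ => by rw [hP, he' i i.2]

lemma exists_g {d : ℕ} (hd : 2 ≤ d) {F1 F2 F3 F1' F2' F3' : ℕ → Submodule ℂ (Fin d → ℂ)}
    (h1 : IsCompleteFlag d F1) (h2 : IsCompleteFlag d F2) (h3 : IsCompleteFlag d F3)
    (h1' : IsCompleteFlag d F1') (h2' : IsCompleteFlag d F2') (h3' : IsCompleteFlag d F3')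
    (hgen : GenPos3 d F1 F2 F3) (hgen' : GenPos3 d F1' F2' F3') :
    ∃ g : Matrix (Fin d) (Fin d) ℂ, IsUnit g ∧ flagMap d g F1 = F1' ∧ flagMap d g F2 = F2' ∧
      flagMap d g F3 1 = F3' 1 := by
  obtain ⟨P, p1, p2, p3⟩ := normal_basis hd h1 h2 h3 hgen
  obtain ⟨Q, q1, q2, q3⟩ := normal_basis hd h1' h2' h3' hgen'
  let L := P.equiv Q (Equiv.refl _)
  have hL : ∀ i, L (P i) = Q i := fun i => by simp [L]
  let g : Matrix (Fin d) (Fin d) ℂ := LinearMap.toMatrix' L.toLinearMap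
  have hgL : g.mulVecLin = L.toLinearMap := by
    rw [← Matrix.toLin'_apply', Matrix.toLin'_toMatrix']
  have hg : IsUnit g := by
    apply Matrix.mulVec_injective_iff_isUnit.1
    change Function.Injective g.mulVecLin
    rw [hgL]
    exact L.injective
  have hset : ∀ S : Set (Fin d), Submodule.map g.mulVecLin (Submodule.span ℂ (P '' S)) =
      Submodule.span ℂ (Q '' S) := by
    intro S
    rw [hgL, Submodule.map_span, Set.image_image]
    congr 1
    exact Set.image_congr fun i _ => hL i
  refine ⟨g, hg, ?_, ?_, ?_⟩
  · funext k
    by_cases hk : k ≤ d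
    · unfold flagMap
      rw [p1 k hk, q1 k hk, hset]
    · rw [flag_top (flagMap_complete hg h1) (by omega), flag_top h1' (by omega)]
  · funext k
    by_cases hk : k ≤ d
    · unfold flagMap
      rw [p2 k hk, q2 k hk, hset]
    · rw [flag_top (flagMap_complete hg h2) (by omega), flag_top h2' (by omega)]
  · unfold flagMap
    rw [p3, q3, hgL, Submodule.map_span, Set.image_singleton]
    simp [hL]

theorem statement_4 (d : ℕ) (hd : 2 ≤ d)
    (F1 F2 F3 F1' F2' F3' : ℕ → Submodule ℂ (Fin d → ℂ))
    (h1 : IsCompleteFlag d F1) (h2 : IsCompleteFlag d F2) (h3 : IsCompleteFlag d F3)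
    (h1' : IsCompleteFlag d F1') (h2' : IsCompleteFlag d F2') (h3' : IsCompleteFlag d F3')
    (hgen : GenPos3 d F1 F2 F3) (hgen' : GenPos3 d F1' F2' F3') :
    (∃ g : Matrix (Fin d) (Fin d) ℂ, IsUnit g ∧
        flagMap d g F1 = F1' ∧ flagMap d g F2 = F2' ∧ flagMap d g F3 = F3') ↔
      ∀ j : ℕ × ℕ × ℕ, memB d j →
        tripleRatio d j F1 F2 F3 = tripleRatio d j F1' F2' F3' := by

  constructor
  · rintro ⟨g, hg, rfl, rfl, rfl⟩ j hj
    exact (tripleRatio_map hg h1 h2 h3 hj).symm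
  · intro hT
    obtain ⟨g, hg, rfl, rfl, e3⟩ := exists_g hd h1 h2 h3 h1' h2' h3' hgen hgen'
    refine ⟨g, hg, rfl, rfl, ?_⟩
    have c3 := flagMap_complete hg h3
    have hG := flagMap_genPos hg hgen
    have hT' : ∀ j : ℕ × ℕ × ℕ, memB d j →
        tripleRatio d j (flagMap d g F1) (flagMap d g F2) (flagMap d g F3) =
          tripleRatio d j (flagMap d g F1) (flagMap d g F2) F3' := fun j hj => by
      rw [tripleRatio_map hg h1 h2 h3 hj, hT j hj]
    have key : ∀ c, c ≤ d → ∀ k, k ≤ c → flagMap d g F3 k = F3' k := by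
      intro c
      induction c with
      | zero =>
        intro _ k hk
        obtain rfl : k = 0 := by omega
        rw [flag_zero c3, flag_zero h3']
      | succ c ih =>
        intro hc k hk
        rcases Nat.lt_or_ge k (c + 1) with hlt | hge
        · exact ih (by omega) k (by omega)
        · obtain rfl : k = c + 1 := by omega
          rcases Nat.eq_zero_or_pos c with rfl | hpos
          · exact e3
          · exact step_lemma h1' h2' c3 h3' hG hgen' hpos (by omega) (ih (by omega)) hT'
    funext k
    by_cases hk : k ≤ d
    · exact key d le_rfl k hk
    · rw [flag_top c3 (by omega), flag_top h3' (by omega)]
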